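/- arXiv:1808.04939 — 3 statements merged into one kernel-verified Lean document; each statement's English description precedes it below -/
import Mathlib

section
/- Fix T > 0 and set D = e − T·e. The function g defined on a neighborhood of 0 in [0,1) by g(0) = 0 and g(x) = x · ln(T + D·e^{−1/x}) for x > 0 is smooth (C^∞), with g(0) = 0, g'(0) = ln T, and g^{(n)}(0) = 0 for all n ≥ 2. -/
open Set

/-- Two functions which are smooth at `a` and agree on a set with unique derivatives
have the same iterated derivatives at the points of that set. -/
theorem iteratedDeriv_eq_of_eqOn {f h : ℝ → ℝ} {s : Set ℝ} {a : ℝ} {n : ℕ}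
    (hs : UniqueDiffOn ℝ s) (ha : a ∈ s) (hf : ContDiffAt ℝ n f a) (hh : ContDiffAt ℝ n h a)
    (hfh : EqOn f h s) : iteratedDeriv n f a = iteratedDeriv n h a := by
  rw [← iteratedDerivWithin_eq_iteratedDeriv hs hf ha,
    ← iteratedDerivWithin_eq_iteratedDeriv hs hh ha]
  exact iteratedDerivWithin_congr hfh ha

theorem iteratedDeriv_mul_const_of_two_le (c : ℝ) {n : ℕ} (hn : 2 ≤ n) (a : ℝ) :
    iteratedDeriv n (fun x : ℝ => x * c) a = 0 := by
  obtain ⟨k, rfl⟩ := Nat.exists_eq_add_of_le' hn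
  have h₁ : deriv (fun x : ℝ => x * c) = fun _ => c := by
    ext x
    simp
  rw [iteratedDeriv_succ', h₁, iteratedDeriv_const]
  simp

/-- For `T > 0` and `D = e − T·e`, the function `g(0) = 0`,
`g(x) = x·ln(T + D·e^{−1/x})` for `x > 0` is smooth (one-sidedly) on a right
neighborhood of `0`, with `g(0) = 0`, `g'(0) = ln T`, and `g⁽ⁿ⁾(0) = 0` for `n ≥ 2`. -/
theorem stmt_2 (T : ℝ) (hT : 0 < T) :
    let D : ℝ := Real.exp 1 - T * Real.exp 1
    let g : ℝ → ℝ := fun x => if x = 0 then 0 else x * Real.log (T + D * Real.exp (-1 / x))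
    ∃ ε > (0:ℝ), ContDiffOn ℝ (⊤ : ℕ∞) g (Ico (0:ℝ) ε) ∧ g 0 = 0 ∧
      iteratedDerivWithin 1 g (Ico (0:ℝ) ε) 0 = Real.log T ∧
      ∀ n : ℕ, 2 ≤ n → iteratedDerivWithin n g (Ico (0:ℝ) ε) 0 = 0 := by
  intro D g
  let G : ℝ → ℝ := fun x => x * Real.log (T + D * expNegInvGlue x)
  have hcont : Continuous fun x => T + D * expNegInvGlue x :=
    continuous_const.add (continuous_const.mul (expNegInvGlue.contDiff (n := 0)).continuous)
  have hpos : ∀ᶠ x in nhds (0 : ℝ), 0 < T + D * expNegInvGlue x :=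
    hcont.continuousAt.eventually_const_lt (by simpa [expNegInvGlue.zero] using hT)
  obtain ⟨ε, hε, hball⟩ := Metric.eventually_nhds_iff.1 hpos
  have hG : ∀ x ∈ Ico (0 : ℝ) ε, ContDiffAt ℝ (⊤ : ℕ∞) G x := by
    intro x hx
    have hne : T + D * expNegInvGlue x ≠ 0 :=
      (hball (by rw [Real.dist_0_eq_abs, abs_of_nonneg hx.1]; exact hx.2)).ne'
    exact contDiffAt_id.mul
      ((contDiffAt_const.add (contDiffAt_const.mul expNegInvGlue.contDiff.contDiffAt)).log hne)
  have hgG : EqOn g G (Ico 0 ε) := by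
    intro x hx
    rcases hx.1.eq_or_lt with rfl | h
    · simp [g, G]
    · simp [g, G, h.ne', expNegInvGlue, h.not_ge, neg_div]
  have h0 : (0 : ℝ) ∈ Ico 0 ε := ⟨le_rfl, hε⟩
  have hderiv : ∀ n : ℕ, iteratedDerivWithin n g (Ico 0 ε) 0 =
      iteratedDeriv n (fun x : ℝ => x * Real.log T) 0 := by
    intro n
    have hGn : ContDiffAt ℝ n G 0 := (hG 0 h0).of_le (by exact_mod_cast le_top)
    rw [iteratedDerivWithin_congr hgG h0,
      iteratedDerivWithin_eq_iteratedDeriv (uniqueDiffOn_Ico 0 ε) hGn h0]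
    refine iteratedDeriv_eq_of_eqOn (uniqueDiffOn_Iic 0) self_mem_Iic hGn
      (contDiffAt_id.mul contDiffAt_const) fun x hx => ?_
    simp [G, expNegInvGlue.zero_of_nonpos hx]
  refine ⟨ε, hε, fun x hx => ((hG x hx).contDiffWithinAt).congr hgG (hgG hx), by simp [g], ?_,
    fun n hn => ?_⟩
  · rw [hderiv, iteratedDeriv_one]
    simp
  · rw [hderiv, iteratedDeriv_mul_const_of_two_le _ hn]
end

section
/- Fix T > 0 and let φ(r) = e^{1/r} − e be the exponential gluing profile. Define B_T : [0,1] → [0,1] by B_T(0) = 0, B_T(1) = 1, and B_T(x) = φ⁻¹(T·φ(x)) for x ∈ (0,1). Then B_T is a smooth diffeomorphism of [0,1] onto itself with B_T(0) = 0 and B_T'(0) = 1. -/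
open Set

/-- The map `x ↦ φ⁻¹(T·φ(x))` for the profile `φ(r) = e^{1/r} − e`, extended by `0` at `0`. -/
noncomputable def expGluingMap (T x : ℝ) : ℝ :=
  if x = 0 then 0 else 1 / Real.log (T * (Real.exp (1 / x) - Real.exp 1) + Real.exp 1)

namespace expGluingMap

variable {T x : ℝ}

@[simp] theorem map_zero (T : ℝ) : expGluingMap T 0 = 0 := by simp [expGluingMap]

@[simp] theorem map_one (T : ℝ) : expGluingMap T 1 = 1 := by simp [expGluingMap]

theorem exp_one_le_exp_one_div (hx : x ∈ Ioc (0 : ℝ) 1) : Real.exp 1 ≤ Real.exp (1 / x) :=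
  Real.exp_le_exp.2 ((one_le_div hx.1).2 hx.2)

theorem exp_one_le_arg (hT : 0 < T) (hx : x ∈ Ioc (0 : ℝ) 1) :
    Real.exp 1 ≤ T * (Real.exp (1 / x) - Real.exp 1) + Real.exp 1 :=
  le_add_of_nonneg_left (mul_nonneg hT.le (sub_nonneg.2 (exp_one_le_exp_one_div hx)))

theorem one_le_log_arg (hT : 0 < T) (hx : x ∈ Ioc (0 : ℝ) 1) :
    1 ≤ Real.log (T * (Real.exp (1 / x) - Real.exp 1) + Real.exp 1) :=
  (Real.le_log_iff_exp_le ((Real.exp_pos 1).trans_le (exp_one_le_arg hT hx))).2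
    (exp_one_le_arg hT hx)

theorem mem_Ioc (hT : 0 < T) (hx : x ∈ Ioc (0 : ℝ) 1) : expGluingMap T x ∈ Ioc (0 : ℝ) 1 := by
  have h := one_le_log_arg hT hx
  rw [expGluingMap, if_neg hx.1.ne']
  exact ⟨one_div_pos.2 (one_pos.trans_le h), (div_le_one (one_pos.trans_le h)).2 h⟩

theorem mapsTo_Icc (hT : 0 < T) : MapsTo (expGluingMap T) (Icc 0 1) (Icc 0 1) := by
  intro x hx
  rcases hx.1.eq_or_lt with rfl | h0
  · simp
  · exact Ioc_subset_Icc_self (mem_Ioc hT ⟨h0, hx.2⟩)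

theorem inv_map (hT : 0 < T) (hx : x ∈ Icc (0 : ℝ) 1) :
    expGluingMap T⁻¹ (expGluingMap T x) = x := by
  rcases hx.1.eq_or_lt with rfl | h0
  · simp
  have hx' : x ∈ Ioc (0 : ℝ) 1 := ⟨h0, hx.2⟩
  have hexp : Real.exp (1 / expGluingMap T x) =
      T * (Real.exp (1 / x) - Real.exp 1) + Real.exp 1 := by
    rw [expGluingMap, if_neg h0.ne', one_div_one_div,
      Real.exp_log ((Real.exp_pos 1).trans_le (exp_one_le_arg hT hx'))]
  rw [expGluingMap, if_neg (mem_Ioc hT hx').1.ne', hexp, add_sub_cancel_right,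
    inv_mul_cancel_left₀ hT.ne', sub_add_cancel, Real.log_exp, one_div_one_div]

theorem map_inv (hT : 0 < T) (hx : x ∈ Icc (0 : ℝ) 1) :
    expGluingMap T (expGluingMap T⁻¹ x) = x := by
  simpa using inv_map (inv_pos.2 hT) hx

theorem bijOn_Icc (hT : 0 < T) : BijOn (expGluingMap T) (Icc 0 1) (Icc 0 1) :=
  InvOn.bijOn (f' := expGluingMap T⁻¹) ⟨fun _ hx => inv_map hT hx, fun _ hx => map_inv hT hx⟩
    (mapsTo_Icc hT) (mapsTo_Icc (inv_pos.2 hT))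

/-- The factor by which `T·φ + e` differs from `e^{1/x}` on `(0, 1]`. -/
noncomputable def correction (T x : ℝ) : ℝ := T + Real.exp 1 * (1 - T) * expNegInvGlue x

theorem arg_eq_exp_mul_correction (T : ℝ) (hx : 0 < x) :
    T * (Real.exp (1 / x) - Real.exp 1) + Real.exp 1 = Real.exp (1 / x) * correction T x := by
  have h : Real.exp (1 / x) * Real.exp (-x⁻¹) = 1 := by
    rw [← Real.exp_add, one_div, add_neg_cancel, Real.exp_zero]
  rw [correction, expNegInvGlue, if_neg hx.not_ge]
  linear_combination -(Real.exp 1 * (1 - T)) * h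

theorem correction_pos (hT : 0 < T) (hx : x ∈ Icc (0 : ℝ) 1) : 0 < correction T x := by
  rcases hx.1.eq_or_lt with rfl | h0
  · simpa [correction] using hT
  · have h := (Real.exp_pos 1).trans_le (exp_one_le_arg hT ⟨h0, hx.2⟩)
    rw [arg_eq_exp_mul_correction T h0] at h
    exact pos_of_mul_pos_right h (Real.exp_pos _).le

theorem mul_log_arg (hT : 0 < T) (hx : x ∈ Ioc (0 : ℝ) 1) :
    x * Real.log (T * (Real.exp (1 / x) - Real.exp 1) + Real.exp 1) =
      1 + x * Real.log (correction T x) := by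
  rw [arg_eq_exp_mul_correction T hx.1, Real.log_mul (Real.exp_ne_zero _)
    (correction_pos hT (Ioc_subset_Icc_self hx)).ne', Real.log_exp, mul_add,
    mul_one_div_cancel hx.1.ne']

theorem denominator_pos (hT : 0 < T) (hx : x ∈ Icc (0 : ℝ) 1) :
    0 < 1 + x * Real.log (correction T x) := by
  rcases hx.1.eq_or_lt with rfl | h0
  · simp
  · rw [← mul_log_arg hT ⟨h0, hx.2⟩]
    exact mul_pos h0 (one_pos.trans_le (one_le_log_arg hT ⟨h0, hx.2⟩))

theorem eq_div (hT : 0 < T) (hx : x ∈ Icc (0 : ℝ) 1) :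
    expGluingMap T x = x / (1 + x * Real.log (correction T x)) := by
  rcases hx.1.eq_or_lt with rfl | h0
  · simp
  · rw [← mul_log_arg hT ⟨h0, hx.2⟩, expGluingMap, if_neg h0.ne', div_mul_cancel_left₀ h0.ne',
      one_div]

theorem contDiff_correction (T : ℝ) : ContDiff ℝ (⊤ : ℕ∞) (correction T) :=
  contDiff_const.add (contDiff_const.mul expNegInvGlue.contDiff)

theorem contDiffOn_denominator (hT : 0 < T) :
    ContDiffOn ℝ (⊤ : ℕ∞) (fun x => 1 + x * Real.log (correction T x)) (Icc 0 1) :=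
  contDiffOn_const.add (contDiffOn_id.mul
    ((contDiff_correction T).contDiffOn.log fun _ hx => (correction_pos hT hx).ne'))

theorem contDiffOn_Icc (hT : 0 < T) : ContDiffOn ℝ (⊤ : ℕ∞) (expGluingMap T) (Icc 0 1) :=
  (contDiffOn_id.div (contDiffOn_denominator hT) fun _ hx => (denominator_pos hT hx).ne').congr
    fun _ hx => eq_div hT hx

theorem derivWithin_zero (hT : 0 < T) : derivWithin (expGluingMap T) (Icc 0 1) 0 = 1 := by
  have h0 : (0 : ℝ) ∈ Icc (0 : ℝ) 1 := by simp
  have hd := ((contDiffOn_denominator hT).differentiableOn (by simp) 0 h0).hasDerivWithinAt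
  have h : HasDerivWithinAt (expGluingMap T) _ (Icc 0 1) 0 :=
    ((hasDerivWithinAt_id (0 : ℝ) (Icc 0 1)).div hd (denominator_pos hT h0).ne').congr
      (fun _ hx => eq_div hT hx) (eq_div hT h0)
  rw [h.derivWithin (uniqueDiffOn_Icc_zero_one 0 h0)]
  simp

end expGluingMap

/-- For `T > 0`, the map `B_T(x) = φ⁻¹(T·φ(x))` (with `B_T(0)=0`), where
`φ(r) = e^{1/r} − e`, is a smooth diffeomorphism of `[0,1]` onto itself with
`B_T(0) = 0` and `B_T'(0) = 1`. -/
theorem stmt_3 (T : ℝ) (hT : 0 < T) :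
    let φ : ℝ → ℝ := fun r => Real.exp (1 / r) - Real.exp 1
    let B : ℝ → ℝ := fun x => if x = 0 then 0 else 1 / Real.log (T * φ x + Real.exp 1)
    ContDiffOn ℝ (⊤ : ℕ∞) B (Icc (0:ℝ) 1) ∧
    Set.BijOn B (Icc (0:ℝ) 1) (Icc (0:ℝ) 1) ∧
    B 0 = 0 ∧ B 1 = 1 ∧
    derivWithin B (Icc (0:ℝ) 1) 0 = 1 ∧
    ∃ Binv : ℝ → ℝ, ContDiffOn ℝ (⊤ : ℕ∞) Binv (Icc (0:ℝ) 1) ∧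
      (∀ x ∈ Icc (0:ℝ) 1, Binv (B x) = x) ∧ (∀ x ∈ Icc (0:ℝ) 1, B (Binv x) = x) := by
  intro φ B
  have hB : B = expGluingMap T := rfl
  rw [hB]
  exact ⟨expGluingMap.contDiffOn_Icc hT, expGluingMap.bijOn_Icc hT, expGluingMap.map_zero T,
    expGluingMap.map_one T, expGluingMap.derivWithin_zero hT, expGluingMap T⁻¹,
    expGluingMap.contDiffOn_Icc (inv_pos.2 hT), fun _ hx => expGluingMap.inv_map hT hx,
    fun _ hx => expGluingMap.map_inv hT hx⟩
end

section
/- Let Ω ⊂ [0,1) × ℝ consist of all pairs (r,c) with either r = 0, or r ∈ (0,1) and φ(r) + c > 0, where φ(r) = e^{1/r} − e. Define B : Ω → [0,1) by B(0,c) = 0 and B(r,c) = φ⁻¹(φ(r) + c) for r > 0. Then B is smooth, and satisfies B(0,c) = 0, ∂_r B(0,c) = 1, ∂_c B(0,c) = 0, and ∂_r^n ∂_c^m B(0,c) = 0 for all n ≥ 2, m ≥ 0. -/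
open Set

open scoped Topology ContDiff

theorem ContDiffOn.iteratedDeriv_snd {f : ℝ × ℝ → ℝ} {U : Set (ℝ × ℝ)} (hU : IsOpen U)
    (hf : ContDiffOn ℝ ∞ f U) (m : ℕ) :
    ContDiffOn ℝ ∞ (fun p : ℝ × ℝ => iteratedDeriv m (fun c => f (p.1, c)) p.2) U := by
  induction m with
  | zero => simpa using hf
  | succ m ih =>
    have hfd := (ih.fderiv_of_isOpen (m := ∞) hU le_rfl).clm_apply
      (contDiffOn_const (c := ((0, 1) : ℝ × ℝ)))
    refine hfd.congr fun p hp => ?_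
    have hd := ((ih.contDiffAt (hU.mem_nhds hp)).differentiableAt (by simp)).hasFDerivAt
    have hc : HasDerivAt (fun c : ℝ => (p.1, c)) ((0, 1) : ℝ × ℝ) p.2 :=
      (hasDerivAt_const p.2 p.1).prodMk (hasDerivAt_id p.2)
    rw [iteratedDeriv_succ]
    exact (hd.comp_hasDerivAt p.2 hc).deriv

/-- The map `(r, c) ↦ r / (1 + r log (1 + c exp (-1/r)))`, extended by `r` to `r ≤ 0`. -/
noncomputable def gluedShift (p : ℝ × ℝ) : ℝ :=
  p.1 / (1 + p.1 * Real.log (1 + p.2 * expNegInvGlue p.1))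

theorem gluedShift_of_nonpos {r : ℝ} (hr : r ≤ 0) (c : ℝ) : gluedShift (r, c) = r := by
  simp [gluedShift, expNegInvGlue.zero_of_nonpos hr]

theorem exp_one_div_mul_expNegInvGlue {r : ℝ} (hr : 0 < r) :
    Real.exp (1 / r) * expNegInvGlue r = 1 := by
  rw [expNegInvGlue, if_neg hr.not_ge, ← Real.exp_add]
  simp

theorem one_add_mul_log_eq {r c : ℝ} (hr : 0 < r) (h : 0 < 1 + c * expNegInvGlue r) :
    1 + r * Real.log (1 + c * expNegInvGlue r) = r * Real.log (Real.exp (1 / r) + c) := by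
  have hE := exp_one_div_mul_expNegInvGlue hr
  have hfac : Real.exp (1 / r) + c = Real.exp (1 / r) * (1 + c * expNegInvGlue r) := by
    linear_combination (-c) * hE
  rw [hfac, Real.log_mul (Real.exp_pos _).ne' h.ne', Real.log_exp]
  field_simp

theorem gluedShift_of_pos {r c : ℝ} (hr : 0 < r) (h : 0 < 1 + c * expNegInvGlue r) :
    gluedShift (r, c) = 1 / Real.log (Real.exp (1 / r) + c) := by
  rw [gluedShift, one_add_mul_log_eq hr h, div_mul_eq_div_div, div_self hr.ne']

theorem continuous_one_add_mul_expNegInvGlue :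
    Continuous fun p : ℝ × ℝ => 1 + p.2 * expNegInvGlue p.1 :=
  continuous_const.add (continuous_snd.mul
    ((expNegInvGlue.contDiff (n := 0)).continuous.comp continuous_fst))

theorem one_add_mul_expNegInvGlue_pos {r c : ℝ} (hr : 0 < r) (h : 0 < Real.exp (1 / r) + c) :
    0 < 1 + c * expNegInvGlue r := by
  have hE := exp_one_div_mul_expNegInvGlue hr
  have := mul_pos h (expNegInvGlue.pos_of_pos hr)
  linarith

/-- The set on which the expression defining `gluedShift` is regular. -/
def gluedShiftDomain : Set (ℝ × ℝ) :=
  {p | 0 < 1 + p.2 * expNegInvGlue p.1} ∩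
    (fun p : ℝ × ℝ => 1 + p.1 * Real.log (1 + p.2 * expNegInvGlue p.1)) ⁻¹' {0}ᶜ

theorem isOpen_gluedShiftDomain : IsOpen gluedShiftDomain := by
  refine ContinuousOn.isOpen_inter_preimage ?_
    (isOpen_lt continuous_const continuous_one_add_mul_expNegInvGlue) isOpen_compl_singleton
  exact continuousOn_const.add (continuousOn_fst.mul
    (continuous_one_add_mul_expNegInvGlue.continuousOn.log fun p hp => ne_of_gt hp))

theorem contDiffOn_gluedShift : ContDiffOn ℝ ∞ gluedShift gluedShiftDomain := by
  have hlin : ContDiff ℝ ∞ fun p : ℝ × ℝ => 1 + p.2 * expNegInvGlue p.1 :=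
    contDiff_const.add (contDiff_snd.mul (expNegInvGlue.contDiff.comp contDiff_fst))
  exact contDiffOn_fst.div (contDiffOn_const.add (contDiffOn_fst.mul
    (hlin.contDiffOn.log fun p hp => ne_of_gt hp.1))) fun p hp => hp.2

theorem mem_gluedShiftDomain_zero (c : ℝ) : ((0 : ℝ), c) ∈ gluedShiftDomain := by
  simp [gluedShiftDomain, expNegInvGlue.zero]

theorem iteratedDerivWithin_iteratedDeriv_gluedShift (n m : ℕ) (c : ℝ) :
    iteratedDerivWithin n (fun r => iteratedDeriv m (fun c' => gluedShift (r, c')) c) (Ici 0) 0 =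
      iteratedDeriv n (fun r : ℝ => iteratedDeriv m (fun _ : ℝ => r) c) 0 := by
  have hsm : ContDiffAt ℝ n (fun r => iteratedDeriv m (fun c' => gluedShift (r, c')) c) 0 := by
    have h := (contDiffOn_gluedShift.iteratedDeriv_snd isOpen_gluedShiftDomain m).contDiffAt
      (isOpen_gluedShiftDomain.mem_nhds (mem_gluedShiftDomain_zero c))
    have hn : (n : WithTop ℕ∞) ≤ ∞ := by exact_mod_cast le_top
    exact (h.of_le hn).comp (0 : ℝ) (contDiffAt_id.prodMk contDiffAt_const)
  have hid : ContDiff ℝ n (fun r : ℝ => iteratedDeriv m (fun _ : ℝ => r) c) := by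
    simp only [iteratedDeriv_const]
    split_ifs
    · exact contDiff_id
    · exact contDiff_const
  rw [iteratedDerivWithin_eq_iteratedDeriv (uniqueDiffOn_Ici 0) hsm self_mem_Ici,
    ← iteratedDerivWithin_eq_iteratedDeriv (uniqueDiffOn_Iic 0) hsm self_mem_Iic,
    ← iteratedDerivWithin_eq_iteratedDeriv (uniqueDiffOn_Iic 0) hid.contDiffAt self_mem_Iic]
  refine iteratedDerivWithin_congr (fun r hr => ?_) self_mem_Iic
  simp only [gluedShift_of_nonpos hr]

/-- On `Ω = {(r,c) : r = 0, or 0 < r < 1 and φ(r)+c > 0}`, the map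
`B(r,c) = φ⁻¹(φ(r)+c)` (with `B(0,c) = 0`) is smooth and satisfies `B(0,c) = 0`,
`∂_r B(0,c) = 1`, `∂_c B(0,c) = 0`, and `∂_r^n ∂_c^m B(0,c) = 0` for `n ≥ 2, m ≥ 0`. -/
theorem stmt_6 :
    let φ : ℝ → ℝ := fun r => Real.exp (1 / r) - Real.exp 1
    let B : ℝ → ℝ → ℝ := fun r c => if r = 0 then 0 else 1 / Real.log (φ r + c + Real.exp 1)
    let Ω : Set (ℝ × ℝ) := {p | p.1 = 0 ∨ (0 < p.1 ∧ p.1 < 1 ∧ 0 < φ p.1 + p.2)}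
    ContDiffOn ℝ (⊤ : ℕ∞) (fun p : ℝ × ℝ => B p.1 p.2) Ω ∧
    (∀ c : ℝ, B 0 c = 0) ∧
    (∀ c : ℝ, derivWithin (fun r => B r c) (Ici (0:ℝ)) 0 = 1) ∧
    (∀ c : ℝ, deriv (fun c' => B 0 c') c = 0) ∧
    (∀ n m : ℕ, 2 ≤ n → ∀ c : ℝ,
      iteratedDerivWithin n (fun r => iteratedDeriv m (fun c' => B r c') c) (Ici (0:ℝ)) 0 = 0) := by
  intro φ B Ω
  have hBeq : ∀ {r c : ℝ}, 0 ≤ r → 0 < 1 + c * expNegInvGlue r → B r c = gluedShift (r, c) := by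
    intro r c hr h
    rcases hr.eq_or_lt with rfl | hr
    · simp [B, gluedShift]
    · rw [gluedShift_of_pos hr h]
      simp only [B, φ, if_neg hr.ne']
      ring_nf
  have hB0 : ∀ c : ℝ, B 0 c = 0 := fun c => if_pos rfl
  have key : ∀ (n m : ℕ) (c : ℝ),
      iteratedDerivWithin n (fun r => iteratedDeriv m (fun c' => B r c') c) (Ici (0 : ℝ)) 0 =
        iteratedDeriv n (fun r : ℝ => iteratedDeriv m (fun _ : ℝ => r) c) 0 := by
    intro n m c
    rw [← iteratedDerivWithin_iteratedDeriv_gluedShift]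
    have heq : ∀ r : ℝ, 0 ≤ r → 0 < 1 + c * expNegInvGlue r →
        iteratedDeriv m (fun c' => B r c') c =
          iteratedDeriv m (fun c' => gluedShift (r, c')) c := by
      intro r hr h
      refine Filter.EventuallyEq.iteratedDeriv_eq m ?_
      have hcont : Continuous fun c' : ℝ => 1 + c' * expNegInvGlue r := by fun_prop
      filter_upwards [(isOpen_lt continuous_const hcont).mem_nhds h] with c' hc'
      exact hBeq hr hc'
    refine Filter.EventuallyEq.iteratedDerivWithin_eq ?_
      (heq 0 le_rfl (by simp [expNegInvGlue.zero]))
    have hcont : Continuous fun r : ℝ => 1 + c * expNegInvGlue r :=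
      continuous_one_add_mul_expNegInvGlue.comp (continuous_id.prodMk continuous_const)
    filter_upwards [self_mem_nhdsWithin, mem_nhdsWithin_of_mem_nhds
      ((isOpen_lt continuous_const hcont).mem_nhds
        (show 0 < 1 + c * expNegInvGlue 0 by simp [expNegInvGlue.zero]))] with r hr h
    exact heq r hr h
  refine ⟨?_, hB0, fun c => ?_, fun c => ?_, fun n m hn c => ?_⟩
  · have hΩ : ∀ p ∈ Ω, p ∈ gluedShiftDomain ∧ B p.1 p.2 = gluedShift p := by
      rintro ⟨r, c⟩ (h | ⟨h0, -, h⟩)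
      · obtain rfl : r = 0 := h
        exact ⟨mem_gluedShiftDomain_zero c, hBeq le_rfl (by simp [expNegInvGlue.zero])⟩
      · have hexp : Real.exp 1 < Real.exp (1 / r) + c := by
          simp only [φ] at h
          linarith
        have hpos := one_add_mul_expNegInvGlue_pos h0 ((Real.exp_pos 1).trans hexp)
        have hlog : 0 < Real.log (Real.exp (1 / r) + c) :=
          Real.log_pos ((Real.one_lt_exp_iff.2 one_pos).trans hexp)
        refine ⟨⟨hpos, ?_⟩, hBeq (le_of_lt h0) hpos⟩
        simp only [mem_preimage, mem_compl_iff, mem_singleton_iff, one_add_mul_log_eq h0 hpos]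
        exact (mul_pos h0 hlog).ne'
    exact (contDiffOn_gluedShift.mono fun p hp => (hΩ p hp).1).congr fun p hp => (hΩ p hp).2
  · have h := key 1 0 c
    simpa [iteratedDerivWithin_one, iteratedDeriv_one] using h
  · simp [hB0]
  · rw [key]
    obtain ⟨k, rfl⟩ := Nat.exists_eq_add_of_le' hn
    simp only [iteratedDeriv_const]
    split_ifs <;> simp [iteratedDeriv_succ', iteratedDeriv_const]
end
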